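/- For every integer n ≥ 3 and every prime power q, χ_{n−1}((n choose 2)×n, q) ≥ q^n − 1: every map Γ from the set of all (n choose 2)×n matrices over F_q to {1, …, L} satisfying Γ(M_1) ≠ Γ(M_2) whenever the rank of M_1 − M_2 equals n − 1 must have L ≥ q^n − 1. -/

import Mathlib

/-- The matrix of the map `w ↦ x ∧ w` in the standard bases, the basis bivectors being indexed
by the pairs `e 0 < e 1` of indices. -/
def wedgeMatrix {F : Type*} [CommRing F] {n : ℕ} (x : Fin n → F) :
    Matrix (Fin 2 ↪o Fin n) (Fin n) F :=
  Matrix.of fun e k => x (e 0) * (Pi.single k 1 : Fin n → F) (e 1) -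
    x (e 1) * (Pi.single k 1 : Fin n → F) (e 0)

theorem wedgeMatrix_sub {F : Type*} [CommRing F] {n : ℕ} (x y : Fin n → F) :
    wedgeMatrix x - wedgeMatrix y = wedgeMatrix (x - y) := by
  ext e k
  simp only [wedgeMatrix, Matrix.sub_apply, Matrix.of_apply, Pi.sub_apply]
  ring

theorem wedgeMatrix_mulVec {F : Type*} [CommRing F] {n : ℕ} (x w : Fin n → F)
    (e : Fin 2 ↪o Fin n) :
    (wedgeMatrix x).mulVec w e = x (e 0) * w (e 1) - x (e 1) * w (e 0) := by
  simp [wedgeMatrix, Matrix.mulVec, dotProduct, sub_mul, Finset.sum_sub_distrib, Pi.single_apply]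

theorem wedgeMatrix_mulVec_eq_zero_iff {F : Type*} [CommRing F] {n : ℕ} (x w : Fin n → F) :
    (wedgeMatrix x).mulVec w = 0 ↔ ∀ i j, x i * w j = x j * w i := by
  constructor
  · intro h
    have key : ∀ i j, i < j → x i * w j = x j * w i := by
      intro i j hij
      have hmono : StrictMono ![i, j] := by
        intro a b hab
        fin_cases a <;> fin_cases b <;> simp_all
      have := congrFun h (OrderEmbedding.ofStrictMono _ hmono)
      rw [wedgeMatrix_mulVec] at this
      simpa [sub_eq_zero] using this
    intro i j
    rcases lt_trichotomy i j with hij | rfl | hij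
    · exact key i j hij
    · rfl
    · exact (key j i hij).symm
  · intro h
    ext e
    simp [wedgeMatrix_mulVec, h (e 0) (e 1)]

theorem rank_wedgeMatrix {F : Type*} [Field F] {n : ℕ} {x : Fin n → F} (hx : x ≠ 0) :
    (wedgeMatrix x).rank = n - 1 := by
  have hker : LinearMap.ker (wedgeMatrix x).mulVecLin = Submodule.span F {x} := by
    ext w
    rw [LinearMap.mem_ker, Matrix.mulVecLin_apply, wedgeMatrix_mulVec_eq_zero_iff,
      Submodule.mem_span_singleton]
    constructor
    · intro h
      obtain ⟨i, hi⟩ := Function.ne_iff.mp hx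
      refine ⟨w i / x i, funext fun j => ?_⟩
      have hi' : x i ≠ 0 := hi
      have := h i j
      simp only [Pi.smul_apply, smul_eq_mul]
      field_simp
      linear_combination -this
    · rintro ⟨a, rfl⟩ i j
      simp only [Pi.smul_apply, smul_eq_mul]
      ring
  have h := (wedgeMatrix x).mulVecLin.finrank_range_add_finrank_ker
  rw [hker, finrank_span_singleton hx, Module.finrank_fin_fun] at h
  rw [Matrix.rank]
  omega

theorem card_fin_two_orderEmbedding (n : ℕ) : Nat.card (Fin 2 ↪o Fin n) = n.choose 2 := by
  rw [Nat.card_congr (Set.powersetCard.ofFinEmbEquiv (n := 2) (I := Fin n)),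
    Set.powersetCard.card, Nat.card_fin]

/-- for every integer n ≥ 3 and every prime power q,
χ_{n−1}((n choose 2)×n, q) ≥ q^n − 1: every exactly (n−1)-distance coloring of the
(n choose 2)×n matrices over F_q with L colors satisfies L ≥ q^n − 1. -/
theorem exactly_distance_coloring_binom_lower_bound (q n L : ℕ)
    (F : Type) [Field F] [Fintype F] (hF : Fintype.card F = q) (hn : 3 ≤ n)
    (Γ : Matrix (Fin (n.choose 2)) (Fin n) F → Fin L)
    (hΓ : ∀ M₁ M₂ : Matrix (Fin (n.choose 2)) (Fin n) F,
      (M₁ - M₂).rank = n - 1 → Γ M₁ ≠ Γ M₂) :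
    q ^ n - 1 ≤ L := by
  let e := (Finite.equivFinOfCardEq (card_fin_two_orderEmbedding n)).symm
  have hinj : Function.Injective
      fun x : Fin n → F => Γ ((wedgeMatrix x).submatrix e (Equiv.refl _)) := by
    intro x y hxy
    by_contra hne
    refine hΓ _ _ ?_ hxy
    change ((wedgeMatrix x - wedgeMatrix y).submatrix e (Equiv.refl _)).rank = n - 1
    rw [wedgeMatrix_sub, Matrix.rank_submatrix, rank_wedgeMatrix (sub_ne_zero.mpr hne)]
  have h := Fintype.card_le_of_injective _ hinj
  rw [Fintype.card_fun, Fintype.card_fin, Fintype.card_fin, hF] at h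
  exact (Nat.sub_le _ _).trans h
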